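/- arXiv:2001.03362 — 3 statements merged into one kernel-verified Lean document; each statement's English description precedes it below -/
import Mathlib

section
/- At most one proposer can issue a proposal with round number n: if there exist quorums Q1 and Q2 and proposers p1 and p2 such that ackBy(a) = some p1 for every a ∈ Q1 and ackBy(a) = some p2 for every a ∈ Q2, then p1 = p2. -/
/-- At most one proposer can obtain a quorum of acknowledgements that incremented
the acknowledged round to round number `n`. -/
theorem at_most_one_proposal_per_round_number {α P : Type*} [DecidableEq α]
    (A : Finset α) (ackBy : α → Option P)
    (Q1 Q2 : Finset α) (p1 p2 : P)
    (hQ1 : Q1 ⊆ A) (hQ1card : A.card / 2 + 1 ≤ Q1.card)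
    (hQ2 : Q2 ⊆ A) (hQ2card : A.card / 2 + 1 ≤ Q2.card)
    (h1 : ∀ a ∈ Q1, ackBy a = some p1)
    (h2 : ∀ a ∈ Q2, ackBy a = some p2) :
    p1 = p2 := by
  obtain ⟨a, ha⟩ : (Q1 ∩ Q2).Nonempty :=
    Finset.inter_nonempty_of_card_lt_card_add_card hQ1 hQ2 (by omega)
  rw [Finset.mem_inter] at ha
  exact Option.some.inj ((h1 a ha.1).symm.trans (h2 a ha.2))
end

section
/- In a Paxos-safe vote record, if a value v is chosen at round r, then every proposal issued at a round r' > r has value v: for all r' > r and all v', prop r' = some v' implies v' = v. -/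
/-- `Q` is a quorum of the acceptor set `A`: a majority subset. -/
def IsQuorum {α : Type*} (A : Finset α) (Q : Finset α) : Prop :=
  Q ⊆ A ∧ A.card / 2 + 1 ≤ Q.card

/-- Every vote is for an actually issued proposal. -/
def VoteValid {α V : Type*} (prop : ℕ → Option V) (voted : α → ℕ → Prop) : Prop :=
  ∀ a r, voted a r → prop r ≠ none

/-- Value `v` is chosen at round `r`: it is the proposal of round `r` and a quorum
voted for it. -/
def ChosenAt {α V : Type*} (A : Finset α) (prop : ℕ → Option V)
    (voted : α → ℕ → Prop) (r : ℕ) (v : V) : Prop :=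
  prop r = some v ∧ ∃ Q : Finset α, IsQuorum A Q ∧ ∀ a ∈ Q, voted a r

/-- The vote record is Paxos-safe: every issued proposal of round `r` was based on a
quorum `Q` such that either no member of `Q` voted below `r`, or the proposal adopts
the value of some round `k < r` in which a member of `Q` voted, with no member of `Q`
voting strictly between `k` and `r`. -/
def PaxosSafe {α V : Type*} (A : Finset α) (prop : ℕ → Option V)
    (voted : α → ℕ → Prop) : Prop :=
  ∀ r v, prop r = some v → ∃ Q : Finset α, IsQuorum A Q ∧
    ((∀ a ∈ Q, ∀ s < r, ¬ voted a s) ∨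
     (∃ k < r, prop k = some v ∧ (∃ a ∈ Q, voted a k) ∧
        ∀ a ∈ Q, ∀ s, k < s → s < r → ¬ voted a s))

/-- Any two quorums intersect. -/
theorem IsQuorum.exists_mem_inter {α : Type*} {A Q₁ Q₂ : Finset α}
    (h₁ : IsQuorum A Q₁) (h₂ : IsQuorum A Q₂) : ∃ a ∈ Q₁, a ∈ Q₂ := by
  classical
  by_contra! h
  have hcard := Finset.card_le_card (Finset.union_subset h₁.1 h₂.1)
  rw [Finset.card_union_of_disjoint (Finset.disjoint_left.2 h)] at hcard
  have := h₁.2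
  have := h₂.2
  omega

/-- Once `v` is chosen at round `r`, every proposal issued at a higher round has
value `v`. -/
theorem proposal_after_chosen_eq {α V : Type*} [DecidableEq α]
    (A : Finset α) (prop : ℕ → Option V) (voted : α → ℕ → Prop)
    (hvalid : VoteValid prop voted) (hsafe : PaxosSafe A prop voted)
    (r : ℕ) (v : V) (hchosen : ChosenAt A prop voted r v) :
    ∀ r' > r, ∀ v', prop r' = some v' → v' = v := by
  obtain ⟨hr, Q, hQ, hvoted⟩ := hchosen
  intro r'
  induction r' using Nat.strong_induction_on with
  | _ r' ih =>
    intro hlt v' hv'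
    obtain ⟨Q', hQ', h⟩ := hsafe r' v' hv'
    obtain ⟨a, haQ, haQ'⟩ := hQ.exists_mem_inter hQ'
    rcases h with hnone | ⟨k, hk, hkv, -, hbetween⟩
    · exact absurd (hvoted a haQ) (hnone a haQ' r hlt)
    · rcases lt_trichotomy k r with hkr | rfl | hrk
      · exact absurd (hvoted a haQ) (hbetween a haQ' r hkr hlt)
      · exact Option.some.inj (hkv.symm.trans hr)
      · exact ih k hk hrk v' hkv
end

section
/- In a Paxos-safe vote record, any two chosen values are equal: if v1 is chosen at round r1 and v2 is chosen at round r2, then v1 = v2. Consequently, two learners cannot learn different values. -/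
/-- Any two quorums of the same acceptor set share an acceptor. -/
theorem IsQuorum.exists_mem_mem {α : Type*} {A Q R : Finset α}
    (hQ : IsQuorum A Q) (hR : IsQuorum A R) : ∃ a ∈ Q, a ∈ R := by
  classical
  obtain ⟨hQA, hQc⟩ := hQ
  obtain ⟨hRA, hRc⟩ := hR
  by_contra! h
  have hdisj : Disjoint Q R := Finset.disjoint_left.mpr h
  have hcard := Finset.card_le_card (Finset.union_subset hQA hRA)
  rw [Finset.card_union_of_disjoint hdisj] at hcard
  omega

/-- Once a value is chosen, every proposal of a later round carries that value. -/
theorem PaxosSafe.eq_of_chosenAt_of_le {α V : Type*} {A : Finset α} {prop : ℕ → Option V}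
    {voted : α → ℕ → Prop} (hsafe : PaxosSafe A prop voted) {r₀ r : ℕ} {v w : V}
    (hv : ChosenAt A prop voted r₀ v) (hle : r₀ ≤ r) (hw : prop r = some w) : v = w := by
  induction r using Nat.strong_induction_on with
  | _ r ih =>
    obtain ⟨hprop, Q, hQ, hvote⟩ := hv
    rcases hle.eq_or_lt with rfl | hlt
    · exact Option.some.inj (hprop.symm.trans hw)
    · obtain ⟨R, hR, hcases⟩ := hsafe r w hw
      obtain ⟨a, haQ, haR⟩ := hQ.exists_mem_mem hR
      rcases hcases with hnone | ⟨k, hkr, hk, -, hbetween⟩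
      · exact absurd (hvote a haQ) (hnone a haR r₀ hlt)
      · have hk₀ : r₀ ≤ k := by
          by_contra! hk_lt
          exact hbetween a haR r₀ hk_lt hlt (hvote a haQ)
        exact ih k hkr hk₀ hk

/-- In a Paxos-safe vote record, any two chosen values are equal, so two learners
cannot learn different values. -/
theorem chosen_values_eq {α V : Type*} [DecidableEq α]
    (A : Finset α) (prop : ℕ → Option V) (voted : α → ℕ → Prop)
    (hvalid : VoteValid prop voted) (hsafe : PaxosSafe A prop voted)
    (r1 r2 : ℕ) (v1 v2 : V)
    (h1 : ChosenAt A prop voted r1 v1) (h2 : ChosenAt A prop voted r2 v2) :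
    v1 = v2 := by
  rcases le_total r1 r2 with h | h
  · exact hsafe.eq_of_chosenAt_of_le h1 h h2.1
  · exact (hsafe.eq_of_chosenAt_of_le h2 h h1.1).symm
end
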